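/- Let s ≥ 1 and let f : [0,1]^s → ℝ be a function whose mixed partial derivatives up to order 2 in each variable are continuous on [0,1]^s. Then the Walsh coefficients of f are absolutely summable: ∑_{k ∈ ℕ₀^s} |f̂(k)| < ∞. -/

import Mathlib

open MeasureTheory Finset
open scoped ENNReal

noncomputable section

/-- The `j`-th binary digit (`j ≥ 1`) of a real number `x ∈ [0,1)`
(using the binary expansion in which infinitely many digits are `0`). -/
def bdigit (x : ℝ) (j : ℕ) : ℕ := ⌊x * 2 ^ j⌋.toNat % 2

/-- The `k`-th (dyadic) Walsh function. -/
def walsh (k : ℕ) (x : ℝ) : ℝ :=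
  (-1 : ℝ) ^ (∑ j ∈ Finset.range k, if k.testBit j then bdigit x (j + 1) else 0)

/-- The multi-dimensional Walsh function. -/
def walshV {s : ℕ} (k : Fin s → ℕ) (x : Fin s → ℝ) : ℝ := ∏ i, walsh (k i) (x i)

/-- The half-open unit cube `[0,1)^s`. -/
def unitCube (s : ℕ) : Set (Fin s → ℝ) := Set.univ.pi fun _ => Set.Ico (0 : ℝ) 1

/-- The closed unit cube `[0,1]^s`. -/
def closedCube (s : ℕ) : Set (Fin s → ℝ) := Set.univ.pi fun _ => Set.Icc (0 : ℝ) 1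

/-- The `k`-th Walsh coefficient of `f`. -/
def walshCoeff {s : ℕ} (f : (Fin s → ℝ) → ℝ) (k : Fin s → ℕ) : ℝ :=
  ∫ x in unitCube s, f x * walshV k x

/-- `z ⊕ 2^{-n}` : flipping the `n`-th binary digit of `z`. -/
def oplus (z : ℝ) (n : ℕ) : ℝ := z + (-1) ^ bdigit z n * ((2 : ℝ) ^ n)⁻¹

/-- The dyadic difference `∂_{i,n}`. -/
def dyadicDiff {s : ℕ} (i : Fin s) (n : ℕ) (g : (Fin s → ℝ) → ℝ) (x : Fin s → ℝ) : ℝ :=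
  2 ^ n * (g (Function.update x i (oplus (x i) n)) - g x)

/-- The function `χ_n`. -/
def chi (n : ℕ) (x y : ℝ) : ℝ :=
  if min x (oplus x n) ≤ y ∧ y ≤ max x (oplus x n) then 2 ^ n else 0

/-- The exponents in the binary expansion of `k`, in decreasing order. -/
def bitsDesc (k : ℕ) : List ℕ := ((List.range k).filter fun j => k.testBit j).reverse

/-- The number `N` of nonzero binary digits of `k`. -/
def numBits (k : ℕ) : ℕ := (bitsDesc k).length

/-- The weight `μ'_u(k) = ∑_{j=1}^{min(u,N)} (a_j + 2)` for scalar `k`. -/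
def muW (u k : ℕ) : ℕ := (((bitsDesc k).take u).map (· + 2)).sum

/-- The weight `μ'_u(k)` for vectors. -/
def muWV {s : ℕ} (u k : Fin s → ℕ) : ℕ := ∑ i, muW (u i) (k i)

/-- `k_{≤}^{u}` : the `u` most significant binary digits of `k`. -/
def kLe (u k : ℕ) : ℕ := (((bitsDesc k).take u).map (2 ^ ·)).sum

/-- `k_{>}^{u}` : the remaining binary digits of `k`. -/
def kGt (u k : ℕ) : ℕ := (((bitsDesc k).drop u).map (2 ^ ·)).sum

/-- The functions `W(k)`, defined inductively by stripping the least significant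
binary digit of `k` (whose exponent is the 2-adic valuation of `k`). -/
def Wfun : ℕ → ℝ → ℝ
  | 0 => fun _ => 1
  | (k + 1) => fun y =>
      ∫ x in Set.Ico (0 : ℝ) 1,
        chi ((k + 1).factorization 2 + 1) x y *
          Wfun ((k + 1) - 2 ^ ((k + 1).factorization 2)) x
  decreasing_by exact Nat.sub_lt (Nat.succ_pos k) (Nat.two_pow_pos _)

/-- Composition of the dyadic differences `∂_{i,a+1}` for `a` running over a list. -/
def dCompCoord {s : ℕ} (i : Fin s) (L : List ℕ) (g : (Fin s → ℝ) → ℝ) : (Fin s → ℝ) → ℝ :=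
  L.foldr (fun a h => dyadicDiff i (a + 1) h) g

/-- The operator `d_{k_u}` : composition over all coordinates `i` of the dyadic
differences `∂_{i,a_{i,j}+1}`, `1 ≤ j ≤ min(u_i, N_i)`. -/
def dComp {s : ℕ} (u k : Fin s → ℕ) (f : (Fin s → ℝ) → ℝ) : (Fin s → ℝ) → ℝ :=
  (List.finRange s).foldr (fun i g => dCompCoord i ((bitsDesc (k i)).take (u i)) g) f

/-- The multi-index `ν` increased by one in coordinate `i`. -/
def addE {s : ℕ} (i : Fin s) (ν : Fin s → ℕ) : Fin s → ℕ := Function.update ν i (ν i + 1)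

/-- `D` is a family of mixed partial derivatives of `f`, of orders up to `u_i` in
the variable `x_i`, each continuous on the closed cube `[0,1]^s`. -/
def HasMixedDerivs {s : ℕ} (u : Fin s → ℕ) (f : (Fin s → ℝ) → ℝ)
    (D : (Fin s → ℕ) → (Fin s → ℝ) → ℝ) : Prop :=
  D (fun _ => 0) = f ∧
    (∀ ν : Fin s → ℕ, (∀ j, ν j ≤ u j) → ContinuousOn (D ν) (closedCube s)) ∧
    ∀ (ν : Fin s → ℕ) (i : Fin s), (∀ j, addE i ν j ≤ u j) →
      ∀ x ∈ closedCube s,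
        HasDerivWithinAt (fun t => D ν (Function.update x i t)) (D (addE i ν) x)
          (Set.Icc 0 1) (x i)

/-- `∫_{[0,1)^{s-|v|}} F dx_{S∖v}` : the inner integral over the coordinates outside `v`
(as a function of the coordinates in `v`). -/
def projInt {s : ℕ} (v : Finset (Fin s)) (F : (Fin s → ℝ) → ℝ) (x : Fin s → ℝ) : ℝ :=
  ∫ y in unitCube s, F fun i => if i ∈ v then x i else y i

/-- The mixed norm `‖F^{(·)}‖_p` : the `L^p` norm (over the coordinates in `v`) of the
integral of `F` over the coordinates outside `v`. -/
def mixedNorm {s : ℕ} (p : ℝ≥0∞) (v : Finset (Fin s)) (F : (Fin s → ℝ) → ℝ) : ℝ≥0∞ :=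
  eLpNorm (projInt v F) p (volume.restrict (unitCube s))

/-- The `ℓ^q` norm of a finite family in `ℝ≥0∞`, with the usual modification at `q = ∞`. -/
def lqNorm {ι : Type*} [Fintype ι] (q : ℝ≥0∞) (a : ι → ℝ≥0∞) : ℝ≥0∞ :=
  if q = ∞ then ⨆ i, a i else (∑ i, a i ^ q.toReal) ^ q.toReal⁻¹

/-- The `h`-th point of the digital net generated by the matrices `C i`. -/
def netPoint {s m n : ℕ} (C : Fin s → Matrix (Fin n) (Fin m) (ZMod 2)) (h : Fin (2 ^ m)) :
    Fin s → ℝ :=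
  fun i => ∑ j : Fin n,
    (((∑ l : Fin m, (if (h : ℕ).testBit (l : ℕ) then (1 : ZMod 2) else 0) * C i j l).val : ℝ) *
      ((2 : ℝ) ^ ((j : ℕ) + 1))⁻¹)

/-- Membership of `k ∈ ℕ₀^s` in the dual net `P^⊥`. -/
def inDual {s m n : ℕ} (C : Fin s → Matrix (Fin n) (Fin m) (ZMod 2)) (k : Fin s → ℕ) : Prop :=
  ∀ l : Fin m, ∑ i, ∑ j : Fin n, C i j l * (if (k i).testBit (j : ℕ) then (1 : ZMod 2) else 0) = 0

open Classical in
/-- `∑_{k_v ∈ P_v^⊥} 2^{-μ'_α(k_v)}`, encoded as a sum over all `k ∈ ℕ₀^s`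
with support exactly `v` lying in the dual net. -/
def dualSum {s m n : ℕ} (α : ℕ) (C : Fin s → Matrix (Fin n) (Fin m) (ZMod 2))
    (v : Finset (Fin s)) : ℝ≥0∞ :=
  ∑' k : Fin s → ℕ,
    if (∀ i, i ∈ v ↔ k i ≠ 0) ∧ inDual C k
    then (2 : ℝ≥0∞) ^ (-(muWV (fun _ => α) k : ℝ)) else 0

theorem bdigit_eq_floor_mod (x : ℝ) (j : ℕ) : bdigit x j = ⌊x * 2 ^ j⌋₊ % 2 := by
  rw [bdigit, Int.floor_toNat]

/-- The effect of flipping a digit on the scaled integer part. -/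
theorem oplus_mul_two_pow (x : ℝ) (n : ℕ) :
    oplus x n * 2 ^ n = x * 2 ^ n + (-1) ^ bdigit x n := by
  have : (2 : ℝ) ^ n ≠ 0 := by positivity
  rw [oplus, add_mul, mul_assoc, inv_mul_cancel₀ this, mul_one]

theorem floor_oplus_of_even {x : ℝ} (hx : 0 ≤ x) {n : ℕ} (h : bdigit x n = 0) :
    ⌊oplus x n * 2 ^ n⌋₊ = ⌊x * 2 ^ n⌋₊ + 1 := by
  rw [oplus_mul_two_pow, h, pow_zero, Nat.floor_add_one (by positivity)]

theorem floor_oplus_of_odd {x : ℝ} {n : ℕ} (h : bdigit x n = 1) :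
    ⌊oplus x n * 2 ^ n⌋₊ = ⌊x * 2 ^ n⌋₊ - 1 := by
  rw [oplus_mul_two_pow, h, pow_one, ← sub_eq_add_neg, Nat.floor_sub_one]

theorem bdigit_eq_zero_or_one (x : ℝ) (n : ℕ) : bdigit x n = 0 ∨ bdigit x n = 1 := by
  unfold bdigit; omega

theorem bdigit_oplus_self {x : ℝ} (hx : 0 ≤ x) (n : ℕ) :
    bdigit (oplus x n) n = 1 - bdigit x n := by
  rcases bdigit_eq_zero_or_one x n with h | h
  · rw [h, bdigit_eq_floor_mod, floor_oplus_of_even hx h]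
    rw [bdigit_eq_floor_mod] at h
    omega
  · rw [h, bdigit_eq_floor_mod, floor_oplus_of_odd h]
    rw [bdigit_eq_floor_mod] at h
    omega

theorem oplus_oplus {x : ℝ} (hx : 0 ≤ x) (n : ℕ) : oplus (oplus x n) n = x := by
  rw [oplus, bdigit_oplus_self hx]
  rcases bdigit_eq_zero_or_one x n with h | h <;> simp [oplus, h]

theorem oplus_nonneg {x : ℝ} (hx : 0 ≤ x) (n : ℕ) : 0 ≤ oplus x n := by
  have h2 : (0 : ℝ) < 2 ^ n := by positivity
  rcases bdigit_eq_zero_or_one x n with h | h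
  · rw [oplus, h]; positivity
  · refine nonneg_of_mul_nonneg_left (b := (2 : ℝ) ^ n) ?_ h2
    rw [oplus_mul_two_pow, h]
    rw [bdigit_eq_floor_mod] at h
    have : 1 ≤ ⌊x * 2 ^ n⌋₊ := by omega
    have := (Nat.one_le_floor_iff _).1 this
    linarith

theorem oplus_mem_Ico {x : ℝ} (hx : x ∈ Set.Ico (0 : ℝ) 1) (a : ℕ) :
    oplus x (a + 1) ∈ Set.Ico (0 : ℝ) 1 := by
  refine ⟨oplus_nonneg hx.1 _, ?_⟩
  have h2 : (0 : ℝ) < 2 ^ (a + 1) := by positivity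
  rcases bdigit_eq_zero_or_one x (a + 1) with h | h
  · refine lt_of_mul_lt_mul_right (a := (2 : ℝ) ^ (a + 1)) ?_ h2.le
    rw [oplus_mul_two_pow, h, pow_zero, one_mul]
    rw [bdigit_eq_floor_mod] at h
    have h3 : ⌊x * 2 ^ (a + 1)⌋₊ < 2 ^ (a + 1) := by
      rw [Nat.floor_lt (mul_nonneg hx.1 h2.le)]
      push_cast
      nlinarith [hx.2]
    have h4 : ⌊x * 2 ^ (a + 1)⌋₊ + 2 ≤ 2 ^ (a + 1) := by
      have h6 : 2 ^ (a + 1) = 2 ^ a * 2 := pow_succ 2 a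
      omega
    have h5 : ((⌊x * 2 ^ (a + 1)⌋₊ : ℝ)) + 2 ≤ 2 ^ (a + 1) := by exact_mod_cast h4
    linarith [Nat.lt_floor_add_one (x * 2 ^ (a + 1))]
  · rw [oplus, h, pow_one]
    have : (0 : ℝ) < (2 ^ (a + 1))⁻¹ := by positivity
    linarith [hx.2]

theorem bdigit_oplus_of_ne {x : ℝ} (hx : 0 ≤ x) {m n : ℕ} (hmn : m ≠ n) :
    bdigit (oplus x n) m = bdigit x m := by
  rcases lt_or_gt_of_ne hmn with h | h
  · obtain ⟨c, rfl⟩ : ∃ c, n = m + (c + 1) := ⟨n - m - 1, by omega⟩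
    have key : ∀ y : ℝ, ⌊y * 2 ^ m⌋₊ = ⌊y * 2 ^ (m + (c + 1))⌋₊ / 2 / 2 ^ c := by
      intro y
      rw [Nat.div_div_eq_div_mul, ← pow_succ', ← Nat.floor_div_natCast]
      congr 1
      push_cast
      rw [pow_add, ← mul_assoc, mul_div_cancel_right₀]
      positivity
    rw [bdigit_eq_floor_mod, bdigit_eq_floor_mod, key, key]
    congr 2
    rcases bdigit_eq_zero_or_one x (m + (c + 1)) with h | h
    · rw [floor_oplus_of_even hx h]
      rw [bdigit_eq_floor_mod] at h
      omega
    · rw [floor_oplus_of_odd h]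
      rw [bdigit_eq_floor_mod] at h
      omega
  · obtain ⟨c, rfl⟩ : ∃ c, m = n + (c + 1) := ⟨m - n - 1, by omega⟩
    have key : oplus x n * 2 ^ (n + (c + 1)) =
        x * 2 ^ (n + (c + 1)) + (-1) ^ bdigit x n * 2 ^ (c + 1) := by
      rw [pow_add, ← mul_assoc, oplus_mul_two_pow]; ring
    rw [bdigit_eq_floor_mod, bdigit_eq_floor_mod, key]
    rcases bdigit_eq_zero_or_one x n with h | h
    · rw [h, pow_zero, one_mul]
      have := Nat.floor_add_natCast (a := x * 2 ^ (n + (c + 1))) (by positivity) (2 ^ (c + 1))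
      push_cast at this
      rw [this, pow_succ 2 c]
      omega
    · have h0 := oplus_nonneg hx n
      have h1 : 2 ^ (c + 1) ≤ ⌊x * 2 ^ (n + (c + 1))⌋₊ := by
        rw [Nat.le_floor_iff (by positivity)]
        have : 0 ≤ oplus x n * 2 ^ (n + (c + 1)) := by positivity
        rw [key, h] at this
        push_cast
        linarith
      rw [h, pow_one, neg_one_mul, ← sub_eq_add_neg]
      have := Nat.floor_sub_natCast (x * 2 ^ (n + (c + 1))) (2 ^ (c + 1))
      push_cast at this
      rw [this]
      rw [pow_succ] at h1 ⊢
      omega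

theorem oplus_sub_self (x : ℝ) (n : ℕ) : oplus x n - x = (-1) ^ bdigit x n * ((2 : ℝ) ^ n)⁻¹ := by
  rw [oplus]; ring

theorem abs_oplus_sub_self (x : ℝ) (n : ℕ) : |oplus x n - x| = ((2 : ℝ) ^ n)⁻¹ := by
  rw [oplus_sub_self, abs_mul, abs_neg_one_pow, one_mul, abs_of_pos (by positivity)]

theorem walsh_eq_prod (k : ℕ) (x : ℝ) :
    walsh k x = ∏ j ∈ Finset.range k, (-1 : ℝ) ^ (if k.testBit j then bdigit x (j + 1) else 0) := by
  rw [walsh, Finset.prod_pow_eq_pow_sum]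

theorem walsh_oplus {k a : ℕ} (h : k.testBit a) {x : ℝ} (hx : 0 ≤ x) :
    walsh k (oplus x (a + 1)) = -walsh k x := by
  have ha : a ∈ Finset.range k :=
    Finset.mem_range.2 (a.lt_two_pow_self.trans_le (Nat.ge_two_pow_of_testBit h))
  rw [walsh_eq_prod, walsh_eq_prod, ← Finset.mul_prod_erase _ _ ha, ← Finset.mul_prod_erase _ _ ha,
    ← neg_mul]
  congr 1
  · rw [if_pos h, if_pos h, bdigit_oplus_self hx]
    rcases bdigit_eq_zero_or_one x (a + 1) with h | h <;> simp [h]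
  · refine Finset.prod_congr rfl fun j hj => ?_
    rw [bdigit_oplus_of_ne hx]
    have := Finset.ne_of_mem_erase hj
    omega

theorem abs_walsh (k : ℕ) (x : ℝ) : |walsh k x| = 1 := abs_neg_one_pow _

theorem measurable_bdigit (n : ℕ) : Measurable fun x => bdigit x n := by
  have : Measurable fun z : ℤ => z.toNat % 2 := measurable_from_top
  exact this.comp (Int.measurable_floor.comp (measurable_id.mul_const _))

theorem measurable_oplus (n : ℕ) : Measurable fun x => oplus x n := by
  have : Measurable fun d : ℕ => (-1 : ℝ) ^ d * ((2 : ℝ) ^ n)⁻¹ := measurable_from_top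
  exact measurable_id.add (this.comp (measurable_bdigit n))

theorem measurable_walsh (k : ℕ) : Measurable (walsh k) := by
  have : Measurable fun d : ℕ => (-1 : ℝ) ^ d := measurable_from_top
  refine this.comp (Finset.measurable_sum _ fun j _ => ?_)
  split_ifs
  · exact measurable_bdigit _
  · exact measurable_const

theorem volume_preimage_oplus_le (a : ℕ) {t : Set ℝ} (ht : MeasurableSet t) :
    volume.restrict (Set.Ico (0 : ℝ) 1) ((fun x => oplus x (a + 1)) ⁻¹' t) ≤
      volume.restrict (Set.Ico (0 : ℝ) 1) t := by
  rw [Measure.restrict_apply (measurable_oplus _ ht), Measure.restrict_apply ht]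
  set h : ℝ := ((2 : ℝ) ^ (a + 1))⁻¹
  have hB : ∀ e, MeasurableSet {x : ℝ | bdigit x (a + 1) = e} := fun e =>
    measurable_bdigit (a + 1) (measurableSet_singleton e)
  have hsub : (fun x => oplus x (a + 1)) ⁻¹' t ∩ Set.Ico 0 1 ⊆
      (fun x => x + h) ⁻¹' ((t ∩ Set.Ico 0 1) \ {x | bdigit x (a + 1) = 0}) ∪
      (fun x => x + -h) ⁻¹' (t ∩ Set.Ico 0 1 ∩ {x | bdigit x (a + 1) = 0}) := by
    rintro x ⟨hxt, hx⟩
    have h1 := oplus_mem_Ico hx a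
    have h2 := bdigit_oplus_self hx.1 (a + 1)
    rcases bdigit_eq_zero_or_one x (a + 1) with hd | hd
    · left
      have he : oplus x (a + 1) = x + h := by simp [oplus, hd, h]
      rw [Set.mem_preimage, ← he]
      exact ⟨⟨hxt, h1⟩, by simp [h2, hd]⟩
    · right
      have he : oplus x (a + 1) = x + -h := by simp [oplus, hd, h]
      rw [Set.mem_preimage, ← he]
      exact ⟨⟨hxt, h1⟩, by simp [h2, hd]⟩
  calc _ ≤ _ := measure_mono hsub
    _ ≤ _ := measure_union_le _ _
    _ = volume ((t ∩ Set.Ico 0 1) \ {x | bdigit x (a + 1) = 0}) +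
        volume (t ∩ Set.Ico 0 1 ∩ {x | bdigit x (a + 1) = 0}) := by
      rw [measure_preimage_add_right, measure_preimage_add_right]
    _ = _ := by rw [add_comm, measure_inter_add_sdiff _ (hB 0)]

theorem measurePreserving_oplus (a : ℕ) :
    MeasurePreserving (fun x => oplus x (a + 1)) (volume.restrict (Set.Ico (0 : ℝ) 1))
      (volume.restrict (Set.Ico (0 : ℝ) 1)) := by
  refine ⟨measurable_oplus _, Measure.ext fun t ht => ?_⟩
  rw [Measure.map_apply (measurable_oplus _) ht]
  refine le_antisymm (volume_preimage_oplus_le a ht) ?_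
  refine le_trans (le_of_eq ?_) (volume_preimage_oplus_le a (measurable_oplus (a + 1) ht))
  rw [Measure.restrict_apply ht,
    Measure.restrict_apply (measurable_oplus _ (measurable_oplus _ ht))]
  congr 1
  ext x
  simp only [Set.mem_inter_iff, Set.mem_preimage, and_congr_left_iff]
  intro hx
  rw [oplus_oplus hx.1]

/-- The normalised difference (up to sign) obtained by flipping a binary digit of one coordinate. -/
def halfDiff {s : ℕ} (i : Fin s) (a : ℕ) (g : (Fin s → ℝ) → ℝ) (x : Fin s → ℝ) : ℝ :=
  (g x - g (Function.update x i (oplus (x i) (a + 1)))) / 2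

theorem restrict_unitCube (s : ℕ) :
    (volume : Measure (Fin s → ℝ)).restrict (unitCube s) =
      Measure.pi fun _ => volume.restrict (Set.Ico (0 : ℝ) 1) := by
  rw [unitCube, volume_pi, Measure.restrict_pi_pi]

theorem measurePreserving_update_oplus {s : ℕ} (i : Fin s) (a : ℕ) :
    MeasurePreserving (fun x : Fin s → ℝ => Function.update x i (oplus (x i) (a + 1)))
      (volume.restrict (unitCube s)) (volume.restrict (unitCube s)) := by
  have h := measurePreserving_pi (fun _ : Fin s => volume.restrict (Set.Ico (0 : ℝ) 1))
    (fun _ : Fin s => volume.restrict (Set.Ico (0 : ℝ) 1))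
    (f := fun j y => if j = i then oplus y (a + 1) else y) (fun j => by
      by_cases h : j = i
      · simpa [h] using measurePreserving_oplus a
      · simp only [h, if_false]
        exact MeasurePreserving.id _)
  have he : (fun x : Fin s → ℝ => Function.update x i (oplus (x i) (a + 1))) =
      fun x j => if j = i then oplus (x j) (a + 1) else x j := by
    funext x j
    by_cases h : j = i
    · subst h; simp
    · simp [h]
  rw [restrict_unitCube, he]
  exact h

theorem abs_walshV {s : ℕ} (k : Fin s → ℕ) (x : Fin s → ℝ) : |walshV k x| = 1 := by
  simp [walshV, Finset.abs_prod, abs_walsh]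

theorem measurable_walshV {s : ℕ} (k : Fin s → ℕ) : Measurable (walshV k) :=
  Finset.measurable_prod _ fun i _ => (measurable_walsh (k i)).comp (measurable_pi_apply i)

theorem walshV_update_oplus {s : ℕ} {k : Fin s → ℕ} {i : Fin s} {a : ℕ} (h : (k i).testBit a)
    {x : Fin s → ℝ} (hx : 0 ≤ x i) :
    walshV k (Function.update x i (oplus (x i) (a + 1))) = -walshV k x := by
  rw [walshV, walshV, ← Finset.mul_prod_erase _ _ (Finset.mem_univ i),
    ← Finset.mul_prod_erase _ _ (Finset.mem_univ i), ← neg_mul]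
  congr 1
  · simp [walsh_oplus h hx]
  · refine Finset.prod_congr rfl fun j hj => ?_
    rw [Function.update_of_ne (Finset.ne_of_mem_erase hj)]

theorem measurableSet_unitCube (s : ℕ) : MeasurableSet (unitCube s) :=
  MeasurableSet.univ_pi fun _ => measurableSet_Ico

theorem MeasureTheory.IntegrableOn.mul_walshV {s : ℕ} {g : (Fin s → ℝ) → ℝ} (hg : IntegrableOn g (unitCube s))
    (k : Fin s → ℕ) : IntegrableOn (fun x => g x * walshV k x) (unitCube s) :=
  Integrable.mul_bdd hg (measurable_walshV k).aestronglyMeasurable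
    (c := 1) (Filter.Eventually.of_forall fun x => by rw [Real.norm_eq_abs, abs_walshV])

theorem MeasureTheory.IntegrableOn.comp_update_oplus {s : ℕ} {g : (Fin s → ℝ) → ℝ}
    (hg : IntegrableOn g (unitCube s)) (i : Fin s) (a : ℕ) :
    IntegrableOn (fun x => g (Function.update x i (oplus (x i) (a + 1)))) (unitCube s) :=
  (measurePreserving_update_oplus i a).integrable_comp_of_integrable hg

theorem MeasureTheory.IntegrableOn.halfDiff {s : ℕ} {g : (Fin s → ℝ) → ℝ}
    (hg : IntegrableOn g (unitCube s)) (i : Fin s) (a : ℕ) :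
    IntegrableOn (halfDiff i a g) (unitCube s) :=
  (Integrable.sub hg (hg.comp_update_oplus i a)).div_const 2

theorem walshCoeff_halfDiff {s : ℕ} {g : (Fin s → ℝ) → ℝ} (hg : IntegrableOn g (unitCube s))
    {k : Fin s → ℕ} {i : Fin s} {a : ℕ} (h : (k i).testBit a) :
    walshCoeff (halfDiff i a g) k = walshCoeff g k := by
  have hT := measurePreserving_update_oplus i a
  have h1 : walshCoeff g k =
      -walshCoeff (fun x => g (Function.update x i (oplus (x i) (a + 1)))) k := by
    rw [walshCoeff, walshCoeff, ← integral_neg]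
    have h2 : IntegrableOn (fun x => g x * walshV k x) (unitCube s) := hg.mul_walshV k
    have h3 := integral_map hT.aemeasurable (f := fun x => g x * walshV k x)
      (by rw [hT.map_eq]; exact h2.aestronglyMeasurable)
    rw [hT.map_eq] at h3
    rw [h3]
    refine setIntegral_congr_fun (measurableSet_unitCube s) fun x hx => ?_
    simp only [walshV_update_oplus h (hx i (Set.mem_univ i)).1, mul_neg]
  have h4 : walshCoeff (halfDiff i a g) k = (walshCoeff g k -
      walshCoeff (fun x => g (Function.update x i (oplus (x i) (a + 1)))) k) / 2 := by
    simp only [walshCoeff]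
    rw [← integral_sub (hg.mul_walshV k) ((hg.comp_update_oplus i a).mul_walshV k),
      ← integral_div]
    congr 1
    ext x
    rw [halfDiff]; ring
  rw [h4]
  linarith

theorem HasDerivWithinAt.halfDiff_of_ne {s : ℕ} {i j : Fin s} (hij : j ≠ i) (a : ℕ)
    {g g' : (Fin s → ℝ) → ℝ} {x : Fin s → ℝ} (hx : x i ∈ Set.Ico (0 : ℝ) 1)
    (h : ∀ p ∈ Set.Ico (0 : ℝ) 1,
      HasDerivWithinAt (fun t => g (Function.update (Function.update x i p) j t))
        (g' (Function.update x i p)) (Set.Icc 0 1) (x j)) :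
    HasDerivWithinAt (fun t => halfDiff i a g (Function.update x j t)) (halfDiff i a g' x)
      (Set.Icc 0 1) (x j) := by
  have h1 := h (x i) hx
  have h2 := h _ (oplus_mem_Ico hx a)
  rw [Function.update_eq_self] at h1
  have he : (fun t => halfDiff i a g (Function.update x j t)) = fun t =>
      (g (Function.update x j t) -
        g (Function.update (Function.update x i (oplus (x i) (a + 1))) j t)) / 2 := by
    funext t
    rw [halfDiff, Function.update_of_ne hij.symm, Function.update_comm hij]
  rw [he]
  exact (h1.sub h2).div_const 2

/-- A mixed second difference is controlled by a bound on the second derivative. -/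
theorem abs_mixed_second_difference_le {φ₀ φ₁ φ₂ : ℝ → ℝ} {M : ℝ}
    (h₀ : ∀ t ∈ Set.Icc (0 : ℝ) 1, HasDerivWithinAt φ₀ (φ₁ t) (Set.Icc 0 1) t)
    (h₁ : ∀ t ∈ Set.Icc (0 : ℝ) 1, HasDerivWithinAt φ₁ (φ₂ t) (Set.Icc 0 1) t)
    (hM : ∀ t ∈ Set.Icc (0 : ℝ) 1, |φ₂ t| ≤ M) {x y q : ℝ}
    (hx : x ∈ Set.Icc (0 : ℝ) 1) (hy : y ∈ Set.Icc (0 : ℝ) 1)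
    (hxq : x + q ∈ Set.Icc (0 : ℝ) 1) (hyq : y + q ∈ Set.Icc (0 : ℝ) 1) :
    |(φ₀ (y + q) - φ₀ y) - (φ₀ (x + q) - φ₀ x)| ≤ M * |q| * |y - x| := by
  set S : Set ℝ := Set.Icc 0 1 ∩ (fun t => t + q) ⁻¹' Set.Icc 0 1 with hS
  have hconv : Convex ℝ S := by
    refine (convex_Icc 0 1).inter ?_
    rw [Set.preimage_add_const_Icc]
    exact convex_Icc _ _
  have hd : ∀ t ∈ S, HasDerivWithinAt (fun t => φ₀ (t + q) - φ₀ t) (φ₁ (t + q) - φ₁ t) S t := by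
    intro t ht
    refine HasDerivWithinAt.sub ?_ ((h₀ t ht.1).mono Set.inter_subset_left)
    have := (h₀ (t + q) ht.2).comp t ((hasDerivWithinAt_id t S).add_const q)
      (fun u hu => hu.2)
    rw [mul_one] at this
    exact this
  have hb : ∀ t ∈ S, ‖φ₁ (t + q) - φ₁ t‖ ≤ M * |q| := by
    intro t ht
    have := (convex_Icc (0 : ℝ) 1).norm_image_sub_le_of_norm_hasDerivWithin_le h₁ hM ht.1 ht.2
    simpa using this
  exact hconv.norm_image_sub_le_of_norm_hasDerivWithin_le hd hb ⟨hx, hxq⟩ ⟨hy, hyq⟩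

theorem abs_halfDiff_le {s : ℕ} (i : Fin s) (a : ℕ) {g₀ g₁ : (Fin s → ℝ) → ℝ} {M : ℝ}
    {x : Fin s → ℝ} (hx : x i ∈ Set.Ico (0 : ℝ) 1)
    (h₀ : ∀ t ∈ Set.Icc (0 : ℝ) 1, HasDerivWithinAt (fun t => g₀ (Function.update x i t))
      (g₁ (Function.update x i t)) (Set.Icc 0 1) t)
    (hM : ∀ t ∈ Set.Icc (0 : ℝ) 1, |g₁ (Function.update x i t)| ≤ M) :
    |halfDiff i a g₀ x| ≤ ((2 : ℝ) ^ a)⁻¹ * M := by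
  have hM0 : 0 ≤ M := (abs_nonneg _).trans (hM _ (Set.Ico_subset_Icc_self hx))
  have := (convex_Icc (0 : ℝ) 1).norm_image_sub_le_of_norm_hasDerivWithin_le h₀ hM
    (Set.Ico_subset_Icc_self (oplus_mem_Ico hx a)) (Set.Ico_subset_Icc_self hx)
  rw [Function.update_eq_self, Real.norm_eq_abs, Real.norm_eq_abs, abs_sub_comm (x i),
    abs_oplus_sub_self] at this
  rw [halfDiff, abs_div, abs_two]
  have h2 : ((2 : ℝ) ^ (a + 1))⁻¹ = ((2 : ℝ) ^ a)⁻¹ / 2 := by rw [pow_succ, mul_inv]; rfl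
  have h3 : 0 ≤ ((2 : ℝ) ^ a)⁻¹ := by positivity
  rw [h2] at this
  nlinarith [mul_nonneg hM0 h3]

theorem abs_halfDiff_halfDiff_le {s : ℕ} (i : Fin s) {a b : ℕ} (hab : a ≠ b)
    {g₀ g₁ g₂ : (Fin s → ℝ) → ℝ} {M : ℝ}
    {x : Fin s → ℝ} (hx : x i ∈ Set.Ico (0 : ℝ) 1)
    (h₀ : ∀ t ∈ Set.Icc (0 : ℝ) 1, HasDerivWithinAt (fun t => g₀ (Function.update x i t))
      (g₁ (Function.update x i t)) (Set.Icc 0 1) t)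
    (h₁ : ∀ t ∈ Set.Icc (0 : ℝ) 1, HasDerivWithinAt (fun t => g₁ (Function.update x i t))
      (g₂ (Function.update x i t)) (Set.Icc 0 1) t)
    (hM : ∀ t ∈ Set.Icc (0 : ℝ) 1, |g₂ (Function.update x i t)| ≤ M) :
    |halfDiff i a (halfDiff i b g₀) x| ≤ ((2 : ℝ) ^ a)⁻¹ * ((2 : ℝ) ^ b)⁻¹ * M := by
  have hM0 : 0 ≤ M := (abs_nonneg _).trans (hM _ (Set.Ico_subset_Icc_self hx))
  set q := oplus (x i) (b + 1) - x i with hq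
  have hxb := oplus_mem_Ico hx b
  have hxa := oplus_mem_Ico hx a
  have hxab := oplus_mem_Ico hxa b
  have e1 : x i + q = oplus (x i) (b + 1) := by rw [hq]; ring
  have e2 : oplus (x i) (a + 1) + q = oplus (oplus (x i) (a + 1)) (b + 1) := by
    have := oplus_sub_self (oplus (x i) (a + 1)) (b + 1)
    rw [bdigit_oplus_of_ne hx.1 (by omega), ← oplus_sub_self, ← hq] at this
    linarith
  have := abs_mixed_second_difference_le h₀ h₁ hM (Set.Ico_subset_Icc_self hx)
    (Set.Ico_subset_Icc_self hxa) (q := q) (by rw [e1]; exact Set.Ico_subset_Icc_self hxb)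
    (by rw [e2]; exact Set.Ico_subset_Icc_self hxab)
  rw [e1, e2, hq, abs_oplus_sub_self, abs_oplus_sub_self, Function.update_eq_self] at this
  have e3 : halfDiff i a (halfDiff i b g₀) x =
      ((g₀ (Function.update x i (oplus (oplus (x i) (a + 1)) (b + 1))) -
        g₀ (Function.update x i (oplus (x i) (a + 1)))) -
        (g₀ (Function.update x i (oplus (x i) (b + 1))) - g₀ x)) / 4 := by
    simp only [halfDiff, Function.update_self, Function.update_idem]
    ring
  rw [e3, abs_div, abs_of_pos (by norm_num : (0 : ℝ) < 4)]
  have h2 : ∀ c : ℕ, ((2 : ℝ) ^ (c + 1))⁻¹ = ((2 : ℝ) ^ c)⁻¹ / 2 := fun c => by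
    rw [pow_succ, mul_inv]; rfl
  have h3 : 0 ≤ ((2 : ℝ) ^ a)⁻¹ * ((2 : ℝ) ^ b)⁻¹ * M := by positivity
  rw [h2, h2] at this
  linarith

/-- The decay `2 ^ (-a₁ - a₂)` of the `k`-th Walsh coefficient of a twice differentiable function,
where `a₁ > a₂` are the positions of the two leading binary digits of `k`. -/
def walshDecay (k : ℕ) : ℝ :=
  ((2 : ℝ) ^ k.log2)⁻¹ * ((2 : ℝ) ^ (k - 2 ^ k.log2).log2)⁻¹

theorem walshDecay_nonneg (k : ℕ) : 0 ≤ walshDecay k := by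
  unfold walshDecay; positivity

/-- For each coordinate there is an operator that leaves the `k`-th Walsh coefficient unchanged,
commutes with derivatives in the other coordinates and has size `walshDecay`. -/
theorem exists_walsh_operator {s : ℕ} (k : Fin s → ℕ) (i : Fin s) :
    ∃ T : ((Fin s → ℝ) → ℝ) → (Fin s → ℝ) → ℝ,
      (∀ g, IntegrableOn g (unitCube s) →
        IntegrableOn (T g) (unitCube s) ∧ walshCoeff (T g) k = walshCoeff g k) ∧
      (∀ j, j ≠ i → ∀ (g g' : (Fin s → ℝ) → ℝ) (x : Fin s → ℝ), x i ∈ Set.Ico (0 : ℝ) 1 →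
        (∀ p ∈ Set.Ico (0 : ℝ) 1,
          HasDerivWithinAt (fun t => g (Function.update (Function.update x i p) j t))
            (g' (Function.update x i p)) (Set.Icc 0 1) (x j)) →
        HasDerivWithinAt (fun t => T g (Function.update x j t)) (T g' x) (Set.Icc 0 1) (x j)) ∧
      (∀ (g₀ g₁ g₂ : (Fin s → ℝ) → ℝ) (M : ℝ) (x : Fin s → ℝ), x i ∈ Set.Ico (0 : ℝ) 1 →
        (∀ t ∈ Set.Icc (0 : ℝ) 1, HasDerivWithinAt (fun t => g₀ (Function.update x i t))
          (g₁ (Function.update x i t)) (Set.Icc 0 1) t) →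
        (∀ t ∈ Set.Icc (0 : ℝ) 1, HasDerivWithinAt (fun t => g₁ (Function.update x i t))
          (g₂ (Function.update x i t)) (Set.Icc 0 1) t) →
        (∀ t ∈ Set.Icc (0 : ℝ) 1, |g₀ (Function.update x i t)| ≤ M) →
        (∀ t ∈ Set.Icc (0 : ℝ) 1, |g₁ (Function.update x i t)| ≤ M) →
        (∀ t ∈ Set.Icc (0 : ℝ) 1, |g₂ (Function.update x i t)| ≤ M) →
        |T g₀ x| ≤ walshDecay (k i) * M) := by
  rcases Nat.eq_zero_or_pos (k i) with h0 | hpos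
  · refine ⟨id, fun g hg => ⟨hg, rfl⟩, fun j hj g g' x hx h => ?_,
      fun g₀ g₁ g₂ M x hx _ _ hM _ _ => ?_⟩
    · have := h (x i) hx
      rwa [Function.update_eq_self] at this
    · have := hM (x i) (Set.Ico_subset_Icc_self hx)
      rw [Function.update_eq_self] at this
      simpa [walshDecay, h0] using this
  have ha : (k i).testBit (k i).log2 := Nat.testBit_log2 hpos.ne'
  set a := (k i).log2 with ha_def
  have hle : 2 ^ a ≤ k i := Nat.log2_self_le hpos.ne'
  rcases Nat.eq_zero_or_pos (k i - 2 ^ a) with hr | hr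
  · refine ⟨halfDiff i a, fun g hg => ⟨hg.halfDiff i a, walshCoeff_halfDiff hg ha⟩,
      fun j hj g g' x hx h => HasDerivWithinAt.halfDiff_of_ne hj a hx h,
      fun g₀ g₁ g₂ M x hx h₀ _ _ hM _ => ?_⟩
    have := abs_halfDiff_le i a hx h₀ hM
    simpa [walshDecay, ← ha_def, hr] using this
  have hb : (k i - 2 ^ a).testBit (k i - 2 ^ a).log2 := Nat.testBit_log2 hr.ne'
  have hlt : (k i - 2 ^ a).log2 < a := by
    rw [Nat.log2_lt hr.ne']
    have : k i < 2 ^ (a + 1) := Nat.lt_log2_self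
    rw [pow_succ] at this
    omega
  have hb' : (k i).testBit (k i - 2 ^ a).log2 := by
    rw [← Nat.testBit_two_pow_add_gt hlt, Nat.add_sub_cancel' hle] at hb
    exact hb
  refine ⟨fun g => halfDiff i a (halfDiff i (k i - 2 ^ a).log2 g),
    fun g hg => ⟨(hg.halfDiff _ _).halfDiff i a, ?_⟩, fun j hj g g' x hx h => ?_,
    fun g₀ g₁ g₂ M x hx h₀ h₁ _ _ hM => ?_⟩
  · rw [walshCoeff_halfDiff (hg.halfDiff _ _) ha, walshCoeff_halfDiff hg hb']
  · refine HasDerivWithinAt.halfDiff_of_ne hj a hx fun p hp => ?_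
    have := HasDerivWithinAt.halfDiff_of_ne (x := Function.update x i p) hj (k i - 2 ^ a).log2
      (g := g) (g' := g') (by simpa using hp) (by
        intro p' hp'
        simpa [Function.update_of_ne hj] using h p' hp')
    rwa [Function.update_of_ne hj] at this
  · exact abs_halfDiff_halfDiff_le i hlt.ne' hx h₀ h₁ hM

theorem exists_partial_walsh_family {s : ℕ} {f : (Fin s → ℝ) → ℝ}
    {D : (Fin s → ℕ) → (Fin s → ℝ) → ℝ} (hf : HasMixedDerivs (fun _ => 2) f D) {M : ℝ}
    (hM : ∀ ν : Fin s → ℕ, (∀ j, ν j ≤ 2) → ∀ x ∈ closedCube s, |D ν x| ≤ M)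
    (hint : IntegrableOn f (unitCube s)) (k : Fin s → ℕ) (S : Finset (Fin s)) :
    ∃ E : (Fin s → ℕ) → (Fin s → ℝ) → ℝ,
      IntegrableOn (E fun _ => 0) (unitCube s) ∧
      walshCoeff (E fun _ => 0) k = walshCoeff f k ∧
      (∀ ν : Fin s → ℕ, (∀ j, ν j ≤ 2) → (∀ j ∈ S, ν j = 0) →
        ∀ x ∈ closedCube s, (∀ j ∈ S, x j ∈ Set.Ico (0 : ℝ) 1) →
          |E ν x| ≤ (∏ j ∈ S, walshDecay (k j)) * M) ∧
      (∀ (ν : Fin s → ℕ) (i : Fin s), i ∉ S → (∀ j, addE i ν j ≤ 2) →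
        ∀ x ∈ closedCube s, (∀ j ∈ S, x j ∈ Set.Ico (0 : ℝ) 1) →
          HasDerivWithinAt (fun t => E ν (Function.update x i t)) (E (addE i ν) x)
            (Set.Icc 0 1) (x i)) := by
  induction S using Finset.induction_on with
  | empty =>
    refine ⟨D, by rwa [hf.1], by rw [hf.1], fun ν hν _ x hx _ => ?_, fun ν i _ hν x hx _ =>
      hf.2.2 ν i hν x hx⟩
    simpa using hM ν hν x hx
  | insert i S hi ih =>
    obtain ⟨E, hE1, hE2, hE3, hE4⟩ := ih
    obtain ⟨T, hT1, hT2, hT3⟩ := exists_walsh_operator k i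
    have hmem : ∀ x ∈ closedCube s, ∀ t ∈ Set.Icc (0 : ℝ) 1,
        Function.update x i t ∈ closedCube s := by
      intro x hx t ht j _
      by_cases h : j = i
      · subst h; simpa using ht
      · simpa [h] using hx j (Set.mem_univ j)
    have hmemS : ∀ x : Fin s → ℝ, (∀ j ∈ insert i S, x j ∈ Set.Ico (0 : ℝ) 1) → ∀ t : ℝ,
        ∀ j ∈ S, Function.update x i t j ∈ Set.Ico (0 : ℝ) 1 := by
      intro x hx t j hj
      rw [Function.update_of_ne (ne_of_mem_of_not_mem hj hi)]
      exact hx j (Finset.mem_insert_of_mem hj)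
    refine ⟨fun ν => T (E ν), (hT1 _ hE1).1, (hT1 _ hE1).2.trans hE2,
      fun ν hν hνS x hx hxS => ?_, fun ν j hj hν x hx hxS => ?_⟩
    · rw [Finset.prod_insert hi, mul_assoc]
      have hνi : ν i = 0 := hνS i (Finset.mem_insert_self _ _)
      have hadd : ∀ (ν : Fin s → ℕ), (∀ j, ν j ≤ 2) → ν i ≤ 1 → ∀ j, addE i ν j ≤ 2 := by
        intro ν hν h j
        by_cases hj : j = i
        · subst hj; simp [addE, h]
        · simpa [addE, hj] using hν j
      have haddS : ∀ (ν : Fin s → ℕ), (∀ j ∈ S, ν j = 0) → ∀ j ∈ S, addE i ν j = 0 := by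
        intro ν hν j hj
        rw [addE, Function.update_of_ne (ne_of_mem_of_not_mem hj hi)]
        exact hν j hj
      have hν1 := hadd ν hν (by omega)
      have hν2 := hadd _ hν1 (by simp [addE, hνi])
      have hS0 : ∀ j ∈ S, ν j = 0 := fun j hj => hνS j (Finset.mem_insert_of_mem hj)
      have hd : ∀ ν : Fin s → ℕ, (∀ j, addE i ν j ≤ 2) → ∀ t ∈ Set.Icc (0 : ℝ) 1,
          HasDerivWithinAt (fun t => E ν (Function.update x i t))
            (E (addE i ν) (Function.update x i t)) (Set.Icc 0 1) t := by
        intro ν hν t ht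
        have := hE4 ν i hi hν _ (hmem x hx t ht) (hmemS x hxS t)
        simpa using this
      refine hT3 (E ν) (E (addE i ν)) (E (addE i (addE i ν))) _ x
        (hxS i (Finset.mem_insert_self _ _)) (hd _ hν1) (hd _ hν2)
        (fun t ht => hE3 _ hν hS0 _ (hmem x hx t ht) (hmemS x hxS t))
        (fun t ht => hE3 _ hν1 (haddS _ hS0) _ (hmem x hx t ht) (hmemS x hxS t))
        (fun t ht => hE3 _ hν2 (haddS _ (haddS _ hS0)) _ (hmem x hx t ht) (hmemS x hxS t))
    · rw [Finset.mem_insert, not_or] at hj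
      refine hT2 j hj.1 _ _ x (hxS i (Finset.mem_insert_self _ _)) fun p hp => ?_
      have := hE4 ν j hj.2 hν _ (hmem x hx p (Set.Ico_subset_Icc_self hp)) (hmemS x hxS p)
      rwa [Function.update_of_ne hj.1] at this

theorem unitCube_subset_closedCube (s : ℕ) : unitCube s ⊆ closedCube s :=
  Set.pi_mono fun _ _ => Set.Ico_subset_Icc_self

theorem volume_unitCube (s : ℕ) : volume (unitCube s) = 1 := by
  rw [unitCube, volume_pi_pi]
  simp

theorem isCompact_closedCube (s : ℕ) : IsCompact (closedCube s) :=
  isCompact_univ_pi fun _ => isCompact_Icc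

theorem abs_walshCoeff_le {s : ℕ} {g : (Fin s → ℝ) → ℝ} {C : ℝ}
    (hC : ∀ x ∈ unitCube s, |g x| ≤ C) (k : Fin s → ℕ) : |walshCoeff g k| ≤ C := by
  have := norm_setIntegral_le_of_norm_le_const (μ := volume) (s := unitCube s)
    (f := fun x => g x * walshV k x) (C := C) (by simp [volume_unitCube]) (fun x hx => by
      rw [norm_mul, Real.norm_eq_abs, Real.norm_eq_abs, abs_walshV, mul_one]
      exact hC x hx)
  simpa [walshCoeff, Measure.real, volume_unitCube] using this

/-- Walsh coefficients of a function with continuous mixed derivatives of order two decay like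
a product of one-dimensional weights. -/
theorem exists_abs_walshCoeff_le {s : ℕ} {f : (Fin s → ℝ) → ℝ}
    {D : (Fin s → ℕ) → (Fin s → ℝ) → ℝ} (hf : HasMixedDerivs (fun _ => 2) f D) :
    ∃ M : ℝ, ∀ k : Fin s → ℕ, |walshCoeff f k| ≤ (∏ i, walshDecay (k i)) * M := by
  have hbdd : ∀ ν : Fin s → ℕ, ∃ C : ℝ, 0 ≤ C ∧ ((∀ j, ν j ≤ 2) →
      ∀ x ∈ closedCube s, |D ν x| ≤ C) := by
    intro ν
    by_cases hν : ∀ j, ν j ≤ 2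
    · obtain ⟨C, hC⟩ := (isCompact_closedCube s).exists_bound_of_continuousOn (hf.2.1 ν hν)
      exact ⟨max C 0, le_max_right _ _, fun _ x hx => (hC x hx).trans (le_max_left _ _)⟩
    · exact ⟨0, le_rfl, fun h => absurd h hν⟩
  choose C hC0 hC using hbdd
  have hM : ∀ ν : Fin s → ℕ, (∀ j, ν j ≤ 2) → ∀ x ∈ closedCube s,
      |D ν x| ≤ ∑ ν ∈ Fintype.piFinset fun _ : Fin s => Finset.range 3, C ν := by
    intro ν hν x hx
    refine (hC ν hν x hx).trans (Finset.single_le_sum (fun ν _ => hC0 ν) ?_)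
    rw [Fintype.mem_piFinset]
    intro j
    rw [Finset.mem_range]
    have := hν j
    omega
  have hint : IntegrableOn f (unitCube s) := by
    have h := (hf.2.1 (fun _ => 0) (fun _ => Nat.zero_le _)).integrableOn_compact (μ := volume)
      (isCompact_closedCube s)
    rw [hf.1] at h
    exact h.mono_set (unitCube_subset_closedCube s)
  refine ⟨∑ ν ∈ Fintype.piFinset fun _ : Fin s => Finset.range 3, C ν, fun k => ?_⟩
  obtain ⟨E, -, hE2, hE3, -⟩ := exists_partial_walsh_family hf hM hint k Finset.univ
  rw [← hE2]
  exact abs_walshCoeff_le (fun x hx => hE3 _ (fun _ => Nat.zero_le _) (fun _ _ => rfl) x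
    (unitCube_subset_closedCube s hx) fun j _ => hx j (Set.mem_univ j)) k

theorem summable_walshDecay : Summable walshDecay := by
  rw [← summable_nat_add_iff 1]
  set c : ℝ := (2 : ℝ) ^ (-(1 / 2) : ℝ) with hc
  have hc0 : 0 ≤ c := by positivity
  have hc1 : c < 1 := Real.rpow_lt_one_of_one_lt_of_neg (by norm_num) (by norm_num)
  have h1 : Summable fun a : ℕ => c ^ a := summable_geometric_of_lt_one hc0 hc1
  have h2 : Summable fun r : ℕ => ((r + 1 : ℕ) : ℝ) ^ (-(3 / 2) : ℝ) :=
    (summable_nat_add_iff 1).2 (Real.summable_nat_rpow.2 (by norm_num))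
  have h3 : Summable fun p : ℕ × ℕ => c ^ p.1 * ((p.2 + 1 : ℕ) : ℝ) ^ (-(3 / 2) : ℝ) :=
    h1.mul_of_nonneg h2 (fun _ => by positivity) (fun _ => by positivity)
  have hinj : Function.Injective fun n : ℕ =>
      ((n + 1).log2, n + 1 - 2 ^ (n + 1).log2) := by
    intro m n h
    simp only [Prod.mk.injEq] at h
    have hm := Nat.log2_self_le (Nat.succ_ne_zero m)
    have hn := Nat.log2_self_le (Nat.succ_ne_zero n)
    rw [Nat.succ_eq_add_one] at hm hn
    rw [h.1] at hm h
    omega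
  refine Summable.of_nonneg_of_le (fun n => walshDecay_nonneg _) (fun n => ?_)
    ((h3.comp_injective hinj).mul_left 2)
  simp only [Function.comp_apply, walshDecay]
  have hlt : n + 1 < 2 ^ ((n + 1).log2 + 1) := Nat.lt_log2_self
  have hle := Nat.log2_self_le (Nat.succ_ne_zero n)
  rw [Nat.succ_eq_add_one] at hle
  set a := (n + 1).log2
  set r := n + 1 - 2 ^ a with hr
  have hra : r + 1 ≤ 2 ^ a := by rw [pow_succ] at hlt; omega
  have hrb : r + 1 ≤ 2 * 2 ^ r.log2 := by
    have : r < 2 ^ (r.log2 + 1) := Nat.lt_log2_self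
    rw [pow_succ] at this
    omega
  have hR : (0 : ℝ) < ((r + 1 : ℕ) : ℝ) := by positivity
  have hraR : ((r + 1 : ℕ) : ℝ) ≤ 2 ^ a := by exact_mod_cast hra
  have hrbR : ((r + 1 : ℕ) : ℝ) ≤ 2 * 2 ^ r.log2 := by exact_mod_cast hrb
  set R : ℝ := ((r + 1 : ℕ) : ℝ)
  have hca : c ^ a = ((2 : ℝ) ^ a) ^ (-(1 / 2) : ℝ) := by
    rw [hc, Real.rpow_pow_comm (by norm_num)]
  have hcc : c ^ a * c ^ a = ((2 : ℝ) ^ a)⁻¹ := by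
    rw [hca, ← Real.rpow_add (by positivity), ← Real.rpow_neg_one]
    norm_num
  have hcR : c ^ a ≤ R ^ (-(1 / 2) : ℝ) := by
    rw [hca]
    exact Real.rpow_le_rpow_of_nonpos hR hraR (by norm_num)
  have hRR : R ^ (-(3 / 2) : ℝ) = R ^ (-(1 / 2) : ℝ) * R⁻¹ := by
    rw [← Real.rpow_neg_one R, ← Real.rpow_add hR]
    norm_num
  have hinv : ((2 : ℝ) ^ r.log2)⁻¹ ≤ 2 * R⁻¹ := by
    rw [← div_eq_mul_inv, inv_le_comm₀ (by positivity) (by positivity), inv_div]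
    linarith
  calc ((2 : ℝ) ^ a)⁻¹ * ((2 : ℝ) ^ r.log2)⁻¹ ≤ (c ^ a * c ^ a) * (2 * R⁻¹) := by
        rw [hcc]; gcongr
    _ ≤ (c ^ a * R ^ (-(1 / 2) : ℝ)) * (2 * R⁻¹) := by gcongr
    _ = 2 * (c ^ a * R ^ (-(3 / 2) : ℝ)) := by rw [hRR]; ring

theorem summable_pi_prod_of_nonneg {s : ℕ} {w : ℕ → ℝ} (h0 : ∀ n, 0 ≤ w n) (hw : Summable w) :
    Summable fun k : Fin s → ℕ => ∏ i, w (k i) := by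
  refine summable_of_sum_le (c := (∑' n, w n) ^ s)
    (fun k => Finset.prod_nonneg fun i _ => h0 _) fun u => ?_
  set N : Finset ℕ := u.biUnion fun k => Finset.univ.image k with hN
  have hsub : u ⊆ Fintype.piFinset fun _ : Fin s => N := by
    intro k hk
    rw [Fintype.mem_piFinset]
    intro i
    exact Finset.mem_biUnion.2 ⟨k, hk, Finset.mem_image_of_mem _ (Finset.mem_univ i)⟩
  calc ∑ k ∈ u, ∏ i, w (k i)
      ≤ ∑ k ∈ Fintype.piFinset fun _ : Fin s => N, ∏ i, w (k i) :=
        Finset.sum_le_sum_of_subset_of_nonneg hsub fun k _ _ =>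
          Finset.prod_nonneg fun i _ => h0 _
    _ = (∑ n ∈ N, w n) ^ s := by
        rw [← Finset.prod_univ_sum]; simp
    _ ≤ (∑' n, w n) ^ s := by
        gcongr
        · exact Finset.sum_nonneg fun n _ => h0 n
        · exact hw.sum_le_tsum N fun n _ => h0 n

/-- if the mixed partial derivatives of `f` up to order `2` in each
variable are continuous on `[0,1]^s`, then the Walsh coefficients of `f` are absolutely
summable. -/
theorem stmt19 {s : ℕ} (hs : 1 ≤ s) (f : (Fin s → ℝ) → ℝ)
    (D : (Fin s → ℕ) → (Fin s → ℝ) → ℝ)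
    (hf : HasMixedDerivs (fun _ => 2) f D) :
    Summable fun k : Fin s → ℕ => |walshCoeff f k| := by
  obtain ⟨M, hM⟩ := exists_abs_walshCoeff_le hf
  exact Summable.of_nonneg_of_le (fun k => abs_nonneg _) hM
    ((summable_pi_prod_of_nonneg walshDecay_nonneg summable_walshDecay).mul_right M)

end
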